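/- Let V be a generalized mixed lattice structure and x ∈ V. For any u ∈ Min[0∨x] there exists an element w ∈ Min[(−x)∨0] such that x = u − w; for this pair one has V_p ∩ Max[u∧w] = {0} and u + w ∈ Min[w∨u]. Conversely, if x = u − w and 0 ∈ Max[u∧w], then u ∈ Min[0∨x] and w ∈ Min[(−x)∨0]. -/

import Mathlib

/-- The set `[x ∨ y] = {w : x ⊑ w ∧ y ≤ w}` of common upper bounds
(`sle` is the specific order `⊑`, `le` the initial order `≤`). -/
def upperSet {V : Type*} (sle le : V → V → Prop) (x y : V) : Set V :=
  {w | sle x w ∧ le y w}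

/-- The set `[x ∧ y] = {w : w ⊑ x ∧ w ≤ y}` of common lower bounds. -/
def lowerSet {V : Type*} (sle le : V → V → Prop) (x y : V) : Set V :=
  {w | sle w x ∧ le w y}

/-- `Min[x ∨ y]`: the minimal elements of `[x ∨ y]` with respect to the initial order `le`. -/
def minUpper {V : Type*} (sle le : V → V → Prop) (x y : V) : Set V :=
  {u | u ∈ upperSet sle le x y ∧ ∀ w ∈ upperSet sle le x y, le w u → w = u}

/-- `Max[x ∧ y]`: the maximal elements of `[x ∧ y]` with respect to the initial order `le`. -/
def maxLower {V : Type*} (sle le : V → V → Prop) (x y : V) : Set V :=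
  {v | v ∈ lowerSet sle le x y ∧ ∀ w ∈ lowerSet sle le x y, le v w → w = v}

/-- A generalized mixed lattice structure on a real vector space `V`:
two partial orders `le` (initial) and `sle` (specific), both compatible with the
vector space structure, with `sle` finer than `le`, and such that the sets
`Min[x ∨ y]` and `Max[x ∧ y]` are nonempty for all `x, y`. -/
structure IsGMLS (V : Type*) [AddCommGroup V] [Module ℝ V]
    (le sle : V → V → Prop) : Prop where
  le_refl : ∀ x, le x x
  le_trans : ∀ x y z, le x y → le y z → le x z
  le_antisymm : ∀ x y, le x y → le y x → x = y
  sle_refl : ∀ x, sle x x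
  sle_trans : ∀ x y z, sle x y → sle y z → sle x z
  sle_antisymm : ∀ x y, sle x y → sle y x → x = y
  add_le_add : ∀ x y z, le x y → le (x + z) (y + z)
  add_sle_add : ∀ x y z, sle x y → sle (x + z) (y + z)
  smul_le_smul : ∀ t : ℝ, 0 < t → ∀ x y, le x y → le (t • x) (t • y)
  smul_sle_smul : ∀ t : ℝ, 0 < t → ∀ x y, sle x y → sle (t • x) (t • y)
  sle_le : ∀ x y, sle x y → le x y
  min_nonempty : ∀ x y, (minUpper sle le x y).Nonempty
  max_nonempty : ∀ x y, (maxLower sle le x y).Nonempty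

namespace IsGMLS

variable {V : Type*} [AddCommGroup V] [Module ℝ V] {le sle : V → V → Prop}

theorem le_add_iff (h : IsGMLS V le sle) {x y : V} (z : V) : le (x + z) (y + z) ↔ le x y :=
  ⟨fun hxy => by simpa using h.add_le_add _ _ (-z) hxy, h.add_le_add _ _ z⟩

theorem sle_add_iff (h : IsGMLS V le sle) {x y : V} (z : V) : sle (x + z) (y + z) ↔ sle x y :=
  ⟨fun hxy => by simpa using h.add_sle_add _ _ (-z) hxy, h.add_sle_add _ _ z⟩

theorem sub_le_self_iff (h : IsGMLS V le sle) {x y : V} : le (x - y) x ↔ le 0 y := by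
  rw [← h.le_add_iff (y - x)]
  abel_nf

theorem sub_le_sub_left_iff (h : IsGMLS V le sle) {x y z : V} :
    le (z - x) (z - y) ↔ le y x := by
  rw [← h.le_add_iff (x + y - z)]
  abel_nf

theorem zero_sle_sub_iff (h : IsGMLS V le sle) {x y : V} : sle 0 (x - y) ↔ sle y x := by
  rw [← h.sle_add_iff y]
  abel_nf

theorem add_mem_upperSet_iff (h : IsGMLS V le sle) {x y u : V} (z : V) :
    u + z ∈ upperSet sle le (x + z) (y + z) ↔ u ∈ upperSet sle le x y :=
  and_congr (h.sle_add_iff z) (h.le_add_iff z)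

/-- The set `Min[x ∨ y]` is translation-invariant. -/
theorem add_mem_minUpper (h : IsGMLS V le sle) {x y u : V} (hu : u ∈ minUpper sle le x y)
    (z : V) : u + z ∈ minUpper sle le (x + z) (y + z) := by
  refine ⟨(h.add_mem_upperSet_iff z).2 hu.1, fun w hw hwu => ?_⟩
  obtain ⟨w, rfl⟩ : ∃ v, w = v + z := ⟨w - z, (sub_add_cancel w z).symm⟩
  rw [hu.2 w ((h.add_mem_upperSet_iff z).1 hw) ((h.le_add_iff z).1 hwu)]

/-- The reflection `v ↦ u - v` exchanges `[u ∧ w]` and `[0 ∨ (u - w)]`. -/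
theorem sub_mem_upperSet_iff (h : IsGMLS V le sle) {u w v : V} :
    u - v ∈ upperSet sle le 0 (u - w) ↔ v ∈ lowerSet sle le u w :=
  and_congr h.zero_sle_sub_iff h.sub_le_sub_left_iff

theorem zero_mem_maxLower_iff (h : IsGMLS V le sle) {u w : V} :
    (0 : V) ∈ maxLower sle le u w ↔ u ∈ minUpper sle le 0 (u - w) := by
  refine and_congr ?_ ⟨fun H z hz hzu => ?_, fun H v hv hv0 => ?_⟩
  · simpa using (h.sub_mem_upperSet_iff (u := u) (w := w) (v := 0)).symm
  · have hv := H (u - z) (h.sub_mem_upperSet_iff.1 (by simpa using hz))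
      ((h.sub_le_self_iff (x := u)).1 (by simpa using hzu))
    exact (sub_eq_zero.1 hv).symm
  · simpa using H (u - v) (h.sub_mem_upperSet_iff.2 hv) (h.sub_le_self_iff.2 hv0)

/-- If `0 ∈ Max[u ∧ w]`, then `0` is the only positive element of `Max[u ∧ w]`. -/
theorem nonneg_inter_maxLower (h : IsGMLS V le sle) {u w : V}
    (h0 : (0 : V) ∈ maxLower sle le u w) : {v : V | le 0 v} ∩ maxLower sle le u w = {0} := by
  refine Set.Subset.antisymm (fun v hv => h0.2 v hv.2.1 hv.1) ?_
  rintro _ rfl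
  exact ⟨h.le_refl 0, h0⟩

end IsGMLS

/-- for any specific upper part `u ∈ Min[0 ∨ x]` there is a lower part
`w ∈ Min[(−x) ∨ 0]` with `x = u − w`, `V_p ∩ Max[u ∧ w] = {0}` and `u + w ∈ Min[w ∨ u]`;
conversely, if `x = u − w` and `0 ∈ Max[u ∧ w]` then `u ∈ Min[0 ∨ x]` and
`w ∈ Min[(−x) ∨ 0]`. -/
theorem specificUpperPart_decomposition {V : Type*} [AddCommGroup V] [Module ℝ V]
    (le sle : V → V → Prop) (h : IsGMLS V le sle) (x : V) :
    (∀ u ∈ minUpper sle le 0 x, ∃ w ∈ minUpper sle le (-x) 0,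
      x = u - w ∧ {v : V | le 0 v} ∩ maxLower sle le u w = {0} ∧
      u + w ∈ minUpper sle le w u) ∧
    (∀ u w : V, x = u - w → (0 : V) ∈ maxLower sle le u w →
      u ∈ minUpper sle le 0 x ∧ w ∈ minUpper sle le (-x) 0) := by
  refine ⟨fun u hu => ⟨u - x, ?_, by abel, ?_, ?_⟩, ?_⟩
  · simpa [sub_eq_add_neg] using h.add_mem_minUpper hu (-x)
  · exact h.nonneg_inter_maxLower (h.zero_mem_maxLower_iff.2 (by simpa using hu))
  · simpa using h.add_mem_minUpper hu (u - x)
  · rintro u w rfl h0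
    have hu := h.zero_mem_maxLower_iff.1 h0
    exact ⟨hu, by simpa using h.add_mem_minUpper hu (-(u - w))⟩
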